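/- If H and K are submonoids of the free monoid A* accepted by deterministic semi-flower automata 𝒜_H and 𝒜_K respectively, each with a unique bpi, and the trim part of the product automaton 𝒜_H × 𝒜_K is a semi-flower automaton with a unique bpi, then r̃k(H ∩ K) ≤ r̃k(H) · r̃k(K). -/

import Mathlib

open Pointwise

/-- A finite automaton over an alphabet `A`, given by its finite set of states,
sets of initial and final states, and set of transitions. -/
structure FA (Q A : Type*) where
  states : Finset Q
  I : Finset Q
  T : Finset Q
  F : Finset (Q × A × Q)
  I_sub : I ⊆ states
  T_sub : T ⊆ states
  F_src : ∀ t ∈ F, t.1 ∈ states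
  F_tgt : ∀ t ∈ F, t.2.2 ∈ states

namespace FA

variable {Q Q' A : Type*}

/-- `M.IsPath p ts q` : `ts` is a (possibly null) path of consecutive transitions
from `p` to `q` in `M`. -/
def IsPath (M : FA Q A) : Q → List (Q × A × Q) → Q → Prop
  | p, [], q => p = q
  | p, t :: ts, q => t ∈ M.F ∧ t.1 = p ∧ M.IsPath t.2.2 ts q

/-- The label of a path, as an element of the free monoid `A*`. -/
def label (ts : List (Q × A × Q)) : FreeMonoid A :=
  FreeMonoid.ofList (ts.map fun t => t.2.1)

/-- The states visited by a path starting at `p`. -/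
def statesOf (p : Q) (ts : List (Q × A × Q)) : List Q :=
  p :: ts.map fun t => t.2.2

/-- A state is accessible if some path leads from an initial state to it. -/
def Accessible (M : FA Q A) (q : Q) : Prop := ∃ i ∈ M.I, ∃ ts, M.IsPath i ts q

/-- A state is coaccessible if some path leads from it to a final state. -/
def Coaccessible (M : FA Q A) (q : Q) : Prop := ∃ t ∈ M.T, ∃ ts, M.IsPath q ts t

/-- An automaton is trim if every state is accessible and coaccessible. -/
def Trim (M : FA Q A) : Prop := ∀ q ∈ M.states, M.Accessible q ∧ M.Coaccessible q

/-- Deterministic: a unique initial state, and at most one transition per state and letter. -/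
def Deterministic (M : FA Q A) : Prop :=
  M.I.card = 1 ∧ ∀ p a q q', (p, a, q) ∈ M.F → (p, a, q') ∈ M.F → q = q'

/-- The language accepted by `M`: labels of paths from an initial to a final state. -/
def lang (M : FA Q A) : Set (FreeMonoid A) :=
  { w | ∃ i ∈ M.I, ∃ t ∈ M.T, ∃ ts, M.IsPath i ts t ∧ label ts = w }

/-- A semi-flower automaton: trim, with unique initial state equal to the unique
final state `one`, and every cycle (non-null path from a state to itself) visits `one`. -/
structure IsSemiFlower (M : FA Q A) (one : Q) : Prop where
  mem : one ∈ M.states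
  init : M.I = {one}
  final : M.T = {one}
  trim : M.Trim
  cyc : ∀ q ts, ts ≠ [] → M.IsPath q ts q → one ∈ statesOf q ts

/-- A cycle simple in `one` : a cycle from `one` to `one` with no intermediate visit to `one`. -/
def SimpleCycleIn (M : FA Q A) (one : Q) (ts : List (Q × A × Q)) : Prop :=
  ts ≠ [] ∧ M.IsPath one ts one ∧ ∀ t ∈ ts.dropLast, t.2.2 ≠ one

/-- `Y_𝒜` : the set of labels of cycles simple in `one`. -/
def Y (M : FA Q A) (one : Q) : Set (FreeMonoid A) :=
  { w | ∃ ts, M.SimpleCycleIn one ts ∧ label ts = w }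

/-- `C_𝒜` : the set of cycles simple in `one`. -/
def C (M : FA Q A) (one : Q) : Set (List (Q × A × Q)) :=
  { ts | M.SimpleCycleIn one ts }

/-- The distance from `p` to `q` : the length of a shortest path from `p` to `q`. -/
noncomputable def dist (M : FA Q A) (p q : Q) : ℕ :=
  sInf { n | ∃ ts, M.IsPath p ts q ∧ ts.length = n }

section Deg

variable [DecidableEq Q] [DecidableEq A]

/-- The indegree of a state: the number of transitions ending at it. -/
def indeg (M : FA Q A) (q : Q) : ℕ := (M.F.filter fun t => t.2.2 = q).card

/-- The outdegree of a state: the number of transitions starting at it. -/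
def outdeg (M : FA Q A) (q : Q) : ℕ := (M.F.filter fun t => t.1 = q).card

/-- A branch point going in (bpi): a state of indegree at least 2. -/
def IsBpi (M : FA Q A) (q : Q) : Prop := 2 ≤ M.indeg q

/-- `BPO_i(𝒜)` : the set of states of outdegree exactly `i`. -/
def BPO (M : FA Q A) (i : ℕ) : Finset Q := M.states.filter fun q => M.outdeg q = i

end Deg

/-- The product automaton. -/
def prod [DecidableEq Q] [DecidableEq Q'] [DecidableEq A]
    (M : FA Q A) (N : FA Q' A) : FA (Q × Q') A where
  states := M.states ×ˢ N.states
  I := M.I ×ˢ N.I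
  T := M.T ×ˢ N.T
  F := ((M.F ×ˢ N.F).filter fun t => t.1.2.1 = t.2.2.1).image
        fun t => ((t.1.1, t.2.1), t.1.2.1, (t.1.2.2, t.2.2.2))
  I_sub := Finset.product_subset_product M.I_sub N.I_sub
  T_sub := Finset.product_subset_product M.T_sub N.T_sub
  F_src := by
    intro t ht
    simp only [Finset.mem_image, Finset.mem_filter, Finset.mem_product] at ht
    obtain ⟨s, ⟨⟨h1, h2⟩, -⟩, rfl⟩ := ht
    exact Finset.mem_product.mpr ⟨M.F_src _ h1, N.F_src _ h2⟩
  F_tgt := by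
    intro t ht
    simp only [Finset.mem_image, Finset.mem_filter, Finset.mem_product] at ht
    obtain ⟨s, ⟨⟨h1, h2⟩, -⟩, rfl⟩ := ht
    exact Finset.mem_product.mpr ⟨M.F_tgt _ h1, N.F_tgt _ h2⟩

open Classical in
/-- The trim part of an automaton: the restriction to states that are both
accessible and coaccessible. -/
noncomputable def trimPart (M : FA Q A) : FA Q A where
  states := M.states.filter fun q => M.Accessible q ∧ M.Coaccessible q
  I := M.I.filter fun q => M.Accessible q ∧ M.Coaccessible q
  T := M.T.filter fun q => M.Accessible q ∧ M.Coaccessible q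
  F := M.F.filter fun t => (M.Accessible t.1 ∧ M.Coaccessible t.1) ∧
        (M.Accessible t.2.2 ∧ M.Coaccessible t.2.2)
  I_sub := by
    intro q hq
    simp only [Finset.mem_filter] at *
    exact ⟨M.I_sub hq.1, hq.2⟩
  T_sub := by
    intro q hq
    simp only [Finset.mem_filter] at *
    exact ⟨M.T_sub hq.1, hq.2⟩
  F_src := by
    intro t ht
    simp only [Finset.mem_filter] at *
    exact ⟨M.F_src _ ht.1, ht.2.1⟩
  F_tgt := by
    intro t ht
    simp only [Finset.mem_filter] at *
    exact ⟨M.F_tgt _ ht.1, ht.2.2⟩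

end FA

/-- The minimal generating set of a submonoid `L` of a free monoid:
`(L ∖ {1}) ∖ (L ∖ {1})·(L ∖ {1})`. -/
def minGen {A : Type*} (L : Set (FreeMonoid A)) : Set (FreeMonoid A) :=
  (L \ {1}) \ ((L \ {1}) * (L \ {1}))

/-- The rank of a submonoid of a free monoid: the cardinality of its (unique)
minimal set of generators. -/
noncomputable def rkL {A : Type*} (L : Set (FreeMonoid A)) : ℕ := (minGen L).ncard

/-- The reduced rank `max (0, rk - 1)` of a submonoid of a free monoid. -/
noncomputable def rrk {A : Type*} (L : Set (FreeMonoid A)) : ℕ := rkL L - 1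

namespace FA

section Paths

variable {Q Q' A : Type*}

theorem isPath_append {M : FA Q A} {p r : Q} {us vs : List (Q × A × Q)} :
    M.IsPath p (us ++ vs) r ↔ ∃ q, M.IsPath p us q ∧ M.IsPath q vs r := by
  induction us generalizing p with
  | nil => simp [IsPath]
  | cons t us ih => simp [IsPath, ih, and_assoc]

theorem isPath_concat {M : FA Q A} {p r : Q} {us : List (Q × A × Q)} {t : Q × A × Q} :
    M.IsPath p (us ++ [t]) r ↔ M.IsPath p us t.1 ∧ t ∈ M.F ∧ t.2.2 = r := by
  rw [isPath_append]
  simp only [IsPath]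
  constructor
  · rintro ⟨q, h, ht, rfl, rfl⟩
    exact ⟨h, ht, rfl⟩
  · rintro ⟨h, ht, rfl⟩
    exact ⟨_, h, ht, rfl, rfl⟩

theorem IsPath.source_unique {M : FA Q A} {p p' q : Q} {ts : List (Q × A × Q)}
    (hp : M.IsPath p ts q) (hp' : M.IsPath p' ts q) : p = p' := by
  cases ts with
  | nil => exact Eq.trans hp (Eq.symm hp')
  | cons t ts => exact hp.2.1.symm.trans hp'.2.1

/-- If a path and a suffix of it start at the same state and end at the same state, then the path
is that suffix, or it comes back to its origin just before the suffix. -/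
theorem IsPath.eq_or_split_of_isSuffix {M : FA Q A} {p r : Q} {xs ys : List (Q × A × Q)}
    (hxs : M.IsPath p xs r) (hys : M.IsPath p ys r) (h : ys <:+ xs) :
    ys = xs ∨ ∃ as a, xs = as ++ a :: ys ∧ a.2.2 = p := by
  obtain ⟨as, rfl⟩ := h
  rcases List.eq_nil_or_concat' as with rfl | ⟨as, a, rfl⟩
  · exact .inl rfl
  · obtain ⟨q, has, hq⟩ := isPath_append.1 hxs
    exact .inr ⟨as, a, by simp, (isPath_concat.1 has).2.2.trans (hq.source_unique hys)⟩

theorem IsPath.mem_F {M : FA Q A} {p q : Q} {ts : List (Q × A × Q)} (h : M.IsPath p ts q)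
    {t : Q × A × Q} (ht : t ∈ ts) : t ∈ M.F := by
  induction ts generalizing p with
  | nil => simp at ht
  | cons s ts ih =>
    rcases List.mem_cons.1 ht with rfl | ht
    · exact h.1
    · exact ih h.2.2 ht

theorem label_append (us vs : List (Q × A × Q)) : label (us ++ vs) = label us * label vs := by
  simp [label]

theorem label_eq_one {ts : List (Q × A × Q)} : label ts = 1 ↔ ts = [] := by
  rw [label, ← FreeMonoid.ofList_nil, FreeMonoid.ofList.injective.eq_iff, List.map_eq_nil_iff]

/-- In an automaton with at most one transition per state and letter, a path is determined by its
origin and its label. -/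
theorem IsPath.eq_of_label_eq {M : FA Q A}
    (hdet : ∀ p a q q', (p, a, q) ∈ M.F → (p, a, q') ∈ M.F → q = q')
    {p q q' : Q} {ts ts' : List (Q × A × Q)} (h : M.IsPath p ts q) (h' : M.IsPath p ts' q')
    (hl : label ts = label ts') : ts = ts' := by
  replace hl : ts.map (fun t => t.2.1) = ts'.map (fun t => t.2.1) := FreeMonoid.ofList.injective hl
  induction ts generalizing p ts' with
  | nil => exact (List.map_eq_nil_iff.1 hl.symm).symm
  | cons t ts ih =>
    cases ts' with
    | nil => simp at hl
    | cons t' ts' =>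
      obtain ⟨p₁, a, r⟩ := t
      obtain ⟨p₂, a', r'⟩ := t'
      simp only [List.map_cons, List.cons.injEq] at hl
      obtain ⟨rfl, hl⟩ := hl
      obtain ⟨ht, rfl, h⟩ := h
      obtain ⟨ht', e, h'⟩ := h'
      simp only at e ht ht' h h'
      subst e
      obtain rfl := hdet _ _ _ _ ht ht'
      rw [ih h h' hl]

theorem IsPath.exists_target_eq_end {M : FA Q A} {p q : Q} {ts : List (Q × A × Q)}
    (h : M.IsPath p ts q) (hne : ts ≠ []) : ∃ t ∈ ts, t.2.2 = q := by
  rcases List.eq_nil_or_concat' ts with rfl | ⟨ts, t, rfl⟩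
  · exact absurd rfl hne
  · exact ⟨t, by simp, (isPath_concat.1 h).2.2⟩

theorem IsPath.exists_target_eq_source {M : FA Q A} {p : Q} {ts : List (Q × A × Q)}
    (h : M.IsPath p ts p) {e : Q × A × Q} (he : e ∈ ts) : ∃ t ∈ ts, t.2.2 = e.1 := by
  obtain ⟨xs, ys, rfl⟩ := List.append_of_mem he
  obtain ⟨q, hxs, -, rfl, -⟩ := isPath_append.1 h
  by_cases hx : xs = []
  · obtain rfl : p = e.1 := by simpa [hx, IsPath] using hxs
    exact h.exists_target_eq_end (by simp)
  · obtain ⟨t, ht, hte⟩ := hxs.exists_target_eq_end hx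
    exact ⟨t, by simp [ht], hte⟩

theorem IsPath.exists_source_eq_target {M : FA Q A} {p q : Q} {e : Q × A × Q}
    {ts : List (Q × A × Q)} (h : M.IsPath p (e :: ts) q) {t : Q × A × Q}
    (ht : t ∈ (e :: ts).dropLast) : ∃ s ∈ ts, s.1 = t.2.2 := by
  induction ts generalizing p e with
  | nil => simp at ht
  | cons u ts ih =>
    rw [List.dropLast_cons_of_ne_nil (by simp), List.mem_cons] at ht
    rcases ht with rfl | ht
    · exact ⟨u, by simp, h.2.2.2.1⟩
    · obtain ⟨s, hs, hst⟩ := ih h.2.2 ht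
      exact ⟨s, by simp [hs], hst⟩

/-- A path to `q` can be cut at its last visit to `one`. -/
theorem IsPath.exists_avoiding_targets {M : FA Q A} {one p q : Q} {ts : List (Q × A × Q)}
    (h : M.IsPath p ts q) :
    (∀ t ∈ ts, t.2.2 ≠ one) ∨ ∃ us, M.IsPath one us q ∧ ∀ t ∈ us, t.2.2 ≠ one := by
  induction ts generalizing p with
  | nil => simp
  | cons t ts ih =>
    rcases ih h.2.2 with hts | hus
    · by_cases ht : t.2.2 = one
      · exact .inr ⟨ts, ht ▸ h.2.2, hts⟩
      · left
        simpa [ht] using hts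
    · exact .inr hus

/-- A path to `one` can be cut at its first visit to `one`. -/
theorem IsPath.exists_avoiding_sources {M : FA Q A} {one p : Q} {ts : List (Q × A × Q)}
    (h : M.IsPath p ts one) : ∃ us, M.IsPath p us one ∧ ∀ t ∈ us, t.1 ≠ one := by
  induction ts generalizing p with
  | nil => exact ⟨[], h, by simp⟩
  | cons t ts ih =>
    by_cases hp : p = one
    · exact ⟨[], hp, by simp⟩
    · obtain ⟨us, hus, hav⟩ := ih h.2.2
      refine ⟨t :: us, ⟨h.1, h.2.1, hus⟩, ?_⟩
      simp only [List.mem_cons, forall_eq_or_imp]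
      exact ⟨h.2.1 ▸ hp, hav⟩

theorem SimpleCycleIn.eq_nil_of_target {M : FA Q A} {one : Q} {us vs : List (Q × A × Q)}
    {t : Q × A × Q} (h : M.SimpleCycleIn one (us ++ t :: vs)) (ht : t.2.2 = one) : vs = [] := by
  by_contra hvs
  refine h.2.2 t ?_ ht
  rw [List.dropLast_append_of_ne_nil (by simp), List.dropLast_cons_of_ne_nil hvs]
  simp

theorem simpleCycleIn_of_forall_split {M : FA Q A} {one : Q} {ts : List (Q × A × Q)}
    (hne : ts ≠ []) (hp : M.IsPath one ts one)
    (h : ∀ us t vs, ts = us ++ t :: vs → t.2.2 = one → vs = []) : M.SimpleCycleIn one ts := by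
  refine ⟨hne, hp, fun t ht hone => ?_⟩
  obtain ⟨us, vs, hs⟩ := List.append_of_mem ht
  have := h us t (vs ++ [ts.getLast hne])
    (by rw [← List.cons_append, ← List.append_assoc, ← hs, List.dropLast_append_getLast]) hone
  simp at this

/-- Paths with a common end, all of whose transitions are the only ones entering their targets,
are comparable for the suffix order. -/
theorem IsPath.isSuffix_or_isSuffix {M : FA Q A} {b : Q}
    (huniq : ∀ t ∈ M.F, ∀ t' ∈ M.F, t.2.2 = t'.2.2 → t.2.2 ≠ b → t = t')
    {p p' r : Q} {ts ts' : List (Q × A × Q)} (h : M.IsPath p ts r) (h' : M.IsPath p' ts' r)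
    (hb : ∀ t ∈ ts, t.2.2 ≠ b) : ts <:+ ts' ∨ ts' <:+ ts := by
  induction ts using List.reverseRecOn generalizing ts' r with
  | nil => simp
  | append_singleton ts t ih =>
    rcases List.eq_nil_or_concat' ts' with rfl | ⟨ts', t', rfl⟩
    · simp
    · rw [isPath_concat] at h h'
      obtain rfl := huniq t h.2.1 t' h'.2.1 (h.2.2.trans h'.2.2.symm) (hb t (by simp))
      have := ih h.1 h'.1 fun s hs => hb s (by simp [hs])
      simpa [List.suffix_append_inj_of_length_eq] using this

end Paths

section Product

variable {Q Q' A : Type*}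

theorem mem_prod_F [DecidableEq Q] [DecidableEq Q'] [DecidableEq A] {M : FA Q A} {N : FA Q' A}
    {t : (Q × Q') × A × (Q × Q')} :
    t ∈ (M.prod N).F ↔ (t.1.1, t.2.1, t.2.2.1) ∈ M.F ∧ (t.1.2, t.2.1, t.2.2.2) ∈ N.F := by
  obtain ⟨⟨p, p'⟩, a, ⟨q, q'⟩⟩ := t
  simp only [prod, Finset.mem_image, Finset.mem_filter, Finset.mem_product]
  constructor
  · rintro ⟨⟨⟨u, x, v⟩, ⟨u', x', v'⟩⟩, ⟨⟨h, h'⟩, e⟩, eq⟩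
    simp only [Prod.mk.injEq] at e eq h h'
    obtain ⟨⟨rfl, rfl⟩, rfl, rfl, rfl⟩ := eq
    subst e
    exact ⟨h, h'⟩
  · rintro ⟨h, h'⟩
    exact ⟨((p, a, q), (p', a, q')), ⟨⟨h, h'⟩, rfl⟩, rfl⟩

theorem trimPart_F_subset (M : FA Q A) : M.trimPart.F ⊆ M.F := by
  classical
  exact Finset.filter_subset _ _

theorem IsPath.mono {M N : FA Q A} (hF : M.F ⊆ N.F) {p q : Q} {ts : List (Q × A × Q)}
    (h : M.IsPath p ts q) : N.IsPath p ts q := by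
  induction ts generalizing p with
  | nil => exact h
  | cons t ts ih => exact ⟨hF h.1, h.2.1, ih h.2.2⟩

theorem IsPath.trimPart {M : FA Q A} {p q : Q} {ts : List (Q × A × Q)}
    (h : M.IsPath p ts q) (hp : M.Accessible p) (hq : M.Coaccessible q) :
    M.trimPart.IsPath p ts q := by
  classical
  induction ts generalizing p with
  | nil => exact h
  | cons t ts ih =>
    obtain ⟨f, hf, vs, hvs⟩ := hq
    obtain ⟨i, hi, us, hus⟩ := hp
    obtain ⟨ht, rfl, h⟩ := h
    have hacc : M.Accessible t.2.2 := ⟨i, hi, us ++ [t], isPath_concat.2 ⟨hus, ht, rfl⟩⟩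
    have hco : M.IsPath t.2.2 (ts ++ vs) f := isPath_append.2 ⟨q, h, hvs⟩
    refine ⟨?_, rfl, ih h hacc⟩
    simp only [FA.trimPart, Finset.mem_filter]
    exact ⟨ht, ⟨⟨i, hi, us, hus⟩, f, hf, t :: (ts ++ vs), ht, rfl, hco⟩, hacc, f, hf, _, hco⟩

theorem lang_trimPart (M : FA Q A) : M.trimPart.lang = M.lang := by
  classical
  ext w
  constructor
  · rintro ⟨i, hi, f, hf, ts, hts, rfl⟩
    exact ⟨i, (Finset.mem_filter.1 hi).1, f, (Finset.mem_filter.1 hf).1, ts,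
      hts.mono M.trimPart_F_subset, rfl⟩
  · rintro ⟨i, hi, f, hf, ts, hts, rfl⟩
    have hai : M.Accessible i := ⟨i, hi, [], rfl⟩
    have hcf : M.Coaccessible f := ⟨f, hf, [], rfl⟩
    exact ⟨i, Finset.mem_filter.2 ⟨hi, hai, f, hf, ts, hts⟩,
      f, Finset.mem_filter.2 ⟨hf, ⟨i, hi, ts, hts⟩, hcf⟩, ts, hts.trimPart hai hcf, rfl⟩

theorem outdeg_mono [DecidableEq Q] {M N : FA Q A} (hF : M.F ⊆ N.F) (q : Q) :
    M.outdeg q ≤ N.outdeg q :=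
  Finset.card_le_card (Finset.filter_subset_filter _ hF)

variable [DecidableEq Q] [DecidableEq Q'] [DecidableEq A]

theorem exists_isPath_prod_iff {M : FA Q A} {N : FA Q' A} {p q : Q} {p' q' : Q'}
    {w : FreeMonoid A} :
    (∃ ts, (M.prod N).IsPath (p, p') ts (q, q') ∧ label ts = w) ↔
      (∃ us, M.IsPath p us q ∧ label us = w) ∧ ∃ vs, N.IsPath p' vs q' ∧ label vs = w := by
  constructor
  · rintro ⟨ts, hts, rfl⟩
    induction ts generalizing p p' with
    | nil =>
      obtain ⟨rfl, rfl⟩ := Prod.mk.inj hts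
      exact ⟨⟨[], rfl, rfl⟩, [], rfl, rfl⟩
    | cons t ts ih =>
      obtain ⟨⟨r, r'⟩, a, ⟨s, s'⟩⟩ := t
      obtain ⟨ht, e, hts⟩ := hts
      obtain ⟨rfl, rfl⟩ := Prod.mk.inj e
      obtain ⟨⟨us, hus, hu⟩, vs, hvs, hv⟩ := ih hts
      rw [mem_prod_F] at ht
      refine ⟨⟨(r, a, s) :: us, ⟨ht.1, rfl, hus⟩, ?_⟩, (r', a, s') :: vs, ⟨ht.2, rfl, hvs⟩, ?_⟩
      · exact congrArg (FreeMonoid.of a * ·) hu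
      · exact congrArg (FreeMonoid.of a * ·) hv
  · rintro ⟨⟨us, hus, rfl⟩, vs, hvs, hl⟩
    replace hl : vs.map (fun t => t.2.1) = us.map (fun t => t.2.1) := FreeMonoid.ofList.injective hl
    induction us generalizing p p' vs with
    | nil =>
      obtain rfl : vs = [] := by simpa using hl
      exact ⟨[], Prod.ext hus hvs, rfl⟩
    | cons u us ih =>
      cases vs with
      | nil => simp at hl
      | cons v vs =>
        obtain ⟨r, a, s⟩ := u
        obtain ⟨r', a', s'⟩ := v
        simp only [List.map_cons, List.cons.injEq] at hl
        obtain ⟨rfl, hl⟩ := hl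
        obtain ⟨hu, rfl, hus⟩ := hus
        obtain ⟨hv, rfl, hvs⟩ := hvs
        obtain ⟨ts, hts, hlab⟩ := ih hus vs hvs hl
        exact ⟨((r, r'), a', (s, s')) :: ts, ⟨mem_prod_F.2 ⟨hu, hv⟩, rfl, hts⟩,
          congrArg (FreeMonoid.of a' * ·) hlab⟩

theorem lang_prod (M : FA Q A) (N : FA Q' A) : (M.prod N).lang = M.lang ∩ N.lang := by
  ext w
  constructor
  · rintro ⟨⟨i, i'⟩, hi, ⟨f, f'⟩, hf, h⟩
    obtain ⟨hM, hN⟩ := exists_isPath_prod_iff.1 h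
    obtain ⟨hi, hi'⟩ := Finset.mem_product.1 hi
    obtain ⟨hf, hf'⟩ := Finset.mem_product.1 hf
    exact ⟨⟨i, hi, f, hf, hM⟩, i', hi', f', hf', hN⟩
  · rintro ⟨⟨i, hi, f, hf, hM⟩, i', hi', f', hf', hN⟩
    exact ⟨(i, i'), Finset.mem_product.2 ⟨hi, hi'⟩, (f, f'), Finset.mem_product.2 ⟨hf, hf'⟩,
      exists_isPath_prod_iff.2 ⟨hM, hN⟩⟩

theorem prod_deterministic {M : FA Q A} {N : FA Q' A} (hM : M.Deterministic)
    (hN : N.Deterministic) : (M.prod N).Deterministic := by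
  refine ⟨by simp [prod, hM.1, hN.1], ?_⟩
  rintro p a ⟨q, q'⟩ ⟨r, r'⟩ h h'
  rw [mem_prod_F] at h h'
  exact Prod.ext (hM.2 _ _ _ _ h.1 h'.1) (hN.2 _ _ _ _ h.2 h'.2)

theorem outdeg_prod_le_left {M : FA Q A} {N : FA Q' A} (hN : N.Deterministic) (q : Q × Q') :
    (M.prod N).outdeg q ≤ M.outdeg q.1 := by
  refine Finset.card_le_card_of_injOn (fun t => (t.1.1, t.2.1, t.2.2.1)) ?_ ?_
  · intro t ht
    obtain ⟨htF, rfl⟩ := Finset.mem_filter.1 (Finset.mem_coe.1 ht)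
    exact Finset.mem_filter.2 ⟨(mem_prod_F.1 htF).1, rfl⟩
  · rintro ⟨r, a, s, s'⟩ ht ⟨r₂, a₂, s₂, s₂'⟩ ht₂ e
    obtain ⟨htF, rfl⟩ := Finset.mem_filter.1 (Finset.mem_coe.1 ht)
    obtain ⟨htF₂, e₂⟩ := Finset.mem_filter.1 (Finset.mem_coe.1 ht₂)
    simp only [Prod.mk.injEq] at e e₂ ⊢
    obtain ⟨-, rfl, rfl⟩ := e
    subst e₂
    exact ⟨rfl, rfl, rfl, hN.2 _ _ _ _ (mem_prod_F.1 htF).2 (mem_prod_F.1 htF₂).2⟩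

theorem outdeg_prod_le_right {M : FA Q A} {N : FA Q' A} (hM : M.Deterministic) (q : Q × Q') :
    (M.prod N).outdeg q ≤ N.outdeg q.2 := by
  refine Finset.card_le_card_of_injOn (fun t => (t.1.2, t.2.1, t.2.2.2)) ?_ ?_
  · intro t ht
    obtain ⟨htF, rfl⟩ := Finset.mem_filter.1 (Finset.mem_coe.1 ht)
    exact Finset.mem_filter.2 ⟨(mem_prod_F.1 htF).2, rfl⟩
  · rintro ⟨r, a, s, s'⟩ ht ⟨r₂, a₂, s₂, s₂'⟩ ht₂ e
    obtain ⟨htF, rfl⟩ := Finset.mem_filter.1 (Finset.mem_coe.1 ht)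
    obtain ⟨htF₂, e₂⟩ := Finset.mem_filter.1 (Finset.mem_coe.1 ht₂)
    simp only [Prod.mk.injEq] at e e₂ ⊢
    obtain ⟨-, rfl, rfl⟩ := e
    subst e₂
    exact ⟨rfl, rfl, hM.2 _ _ _ _ (mem_prod_F.1 htF).1 (mem_prod_F.1 htF₂).1, rfl⟩

end Product

theorem eq_of_target_eq_of_unique_bpi {Q A : Type*} [DecidableEq Q] {M : FA Q A} {b : Q}
    (hub : ∀ q, M.IsBpi q → q = b) :
    ∀ t ∈ M.F, ∀ t' ∈ M.F, t.2.2 = t'.2.2 → t.2.2 ≠ b → t = t' := by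
  intro t ht t' ht' e hne
  by_contra hcon
  exact hne (hub _ (Finset.one_lt_card.2
    ⟨t, Finset.mem_filter.2 ⟨ht, rfl⟩, t', Finset.mem_filter.2 ⟨ht', e.symm⟩, hcon⟩))

namespace IsSemiFlower

variable {Q A : Type*} {M : FA Q A} {one : Q}

theorem exists_path_from_one (h : M.IsSemiFlower one) {q : Q} (hq : q ∈ M.states) :
    ∃ ts, M.IsPath one ts q ∧ ∀ t ∈ ts, t.2.2 ≠ one := by
  obtain ⟨i, hi, ts, hts⟩ := (h.trim q hq).1
  obtain rfl : i = one := by simpa [h.init] using hi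
  exact hts.exists_avoiding_targets.elim (fun hav => ⟨ts, hts, hav⟩) id

theorem exists_path_to_one (h : M.IsSemiFlower one) {q : Q} (hq : q ∈ M.states) :
    ∃ ts, M.IsPath q ts one ∧ ∀ t ∈ ts, t.1 ≠ one := by
  obtain ⟨i, hi, ts, hts⟩ := (h.trim q hq).2
  obtain rfl : i = one := by simpa [h.final] using hi
  exact hts.exists_avoiding_sources

theorem mem_lang_iff (h : M.IsSemiFlower one) {w : FreeMonoid A} :
    w ∈ M.lang ↔ ∃ ts, M.IsPath one ts one ∧ label ts = w := by
  simp [lang, h.init, h.final]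

theorem exists_target (h : M.IsSemiFlower one) (hF : M.F.Nonempty) {q : Q} (hq : q ∈ M.states) :
    ∃ t ∈ M.F, t.2.2 = q := by
  obtain ⟨e, he⟩ := hF
  obtain ⟨us, hus, -⟩ := h.exists_path_to_one (M.F_tgt e he)
  obtain ⟨vs, hvs, -⟩ := h.exists_path_from_one hq
  have hp : M.IsPath e.1 (e :: (us ++ vs)) q := ⟨he, rfl, isPath_append.2 ⟨_, hus, hvs⟩⟩
  rcases List.eq_nil_or_concat' (e :: (us ++ vs)) with hn | ⟨ts, t, hts⟩
  · simp at hn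
  · rw [hts, isPath_concat] at hp
    exact ⟨t, hp.2⟩

theorem exists_source (h : M.IsSemiFlower one) (hF : M.F.Nonempty) {q : Q} (hq : q ∈ M.states) :
    ∃ t ∈ M.F, t.1 = q := by
  obtain ⟨e, he⟩ := hF
  obtain ⟨us, hus, -⟩ := h.exists_path_to_one hq
  obtain ⟨vs, hvs, -⟩ := h.exists_path_from_one (M.F_src e he)
  have hp : M.IsPath q ((us ++ vs) ++ [e]) e.2.2 :=
    isPath_concat.2 ⟨isPath_append.2 ⟨_, hus, hvs⟩, he, rfl⟩
  cases hts : (us ++ vs) ++ [e] with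
  | nil => simp at hts
  | cons t ts =>
    rw [hts] at hp
    exact ⟨t, hp.1, hp.2.1⟩

/-- The minimal generators are the labels of the cycles simple in `one`. -/
theorem minGen_lang (h : M.IsSemiFlower one) (hdet : M.Deterministic) :
    minGen M.lang = M.Y one := by
  ext w
  constructor
  · rintro ⟨⟨hw, hw1⟩, hdec⟩
    obtain ⟨ts, hts, rfl⟩ := h.mem_lang_iff.1 hw
    refine ⟨ts, simpleCycleIn_of_forall_split (mt label_eq_one.2 hw1) hts ?_, rfl⟩
    rintro us t vs rfl ht
    by_contra hvs
    rw [List.append_cons] at hts hdec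
    obtain ⟨q, hus, hvs'⟩ := isPath_append.1 hts
    obtain rfl : one = q := ht.symm.trans (isPath_concat.1 hus).2.2
    exact hdec ⟨_, ⟨h.mem_lang_iff.2 ⟨_, hus, rfl⟩, by simp [label_eq_one]⟩,
      _, ⟨h.mem_lang_iff.2 ⟨_, hvs', rfl⟩, by simpa [label_eq_one] using hvs⟩,
      (label_append _ _).symm⟩
  · rintro ⟨ts, hts, rfl⟩
    refine ⟨⟨h.mem_lang_iff.2 ⟨ts, hts.2.1, rfl⟩, mt label_eq_one.1 hts.1⟩, ?_⟩
    rintro ⟨u, ⟨hu, hu1⟩, v, ⟨hv, hv1⟩, huv⟩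
    obtain ⟨us, hus, rfl⟩ := h.mem_lang_iff.1 hu
    obtain ⟨vs, hvs, rfl⟩ := h.mem_lang_iff.1 hv
    obtain rfl : us ++ vs = ts :=
      (isPath_append.2 ⟨one, hus, hvs⟩).eq_of_label_eq hdet.2 hts.2.1 ((label_append _ _).trans huv)
    rcases List.eq_nil_or_concat' us with rfl | ⟨us, t, rfl⟩
    · exact hu1 rfl
    · rw [List.append_assoc] at hts
      exact hv1 (label_eq_one.2 (hts.eq_nil_of_target (isPath_concat.1 hus).2.2))

/-- A simple cycle enters each state at most once. -/
theorem target_ne_of_simpleCycleIn (h : M.IsSemiFlower one)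
    {us vs : List (Q × A × Q)} {t t' : Q × A × Q} (hc : M.SimpleCycleIn one (us ++ t :: vs))
    (ht' : t' ∈ vs) : t'.2.2 ≠ t.2.2 := by
  intro e
  obtain ⟨xs, ys, rfl⟩ := List.append_of_mem ht'
  have htone : t.2.2 ≠ one := fun e => by simpa using hc.eq_nil_of_target e
  have hcyc : M.IsPath t.2.2 (xs ++ [t']) t.2.2 := by
    obtain ⟨_, -, -, rfl, hp⟩ := isPath_append.1 hc.2.1
    obtain ⟨_, hxs, ht', rfl, -⟩ := isPath_append.1 hp
    exact isPath_concat.2 ⟨hxs, ht', e⟩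
  have hone := h.cyc _ _ (by simp) hcyc
  simp only [statesOf, List.map_append, List.map_cons, List.map_nil, List.mem_cons,
    List.mem_append, List.not_mem_nil, or_false, List.mem_map] at hone
  rcases hone with e' | ⟨s, hs, e'⟩ | e'
  · exact htone e'.symm
  · obtain ⟨as, bs, rfl⟩ := List.append_of_mem hs
    have := SimpleCycleIn.eq_nil_of_target (us := us ++ t :: as) (t := s) (by simpa using hc) e'
    simp at this
  · exact htone (e.symm.trans e'.symm)

section Bpi

variable {b : Q}

/-- A cycle simple in `one` enters the unique bpi. -/
theorem exists_mem_target_eq (h : M.IsSemiFlower one)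
    (huniq : ∀ t ∈ M.F, ∀ t' ∈ M.F, t.2.2 = t'.2.2 → t.2.2 ≠ b → t = t') (hb : b ∈ M.states)
    {ts : List (Q × A × Q)} (hne : ts ≠ []) (hp : M.IsPath one ts one) : ∃ e ∈ ts, e.2.2 = b := by
  by_contra! hav
  have hback : ∀ us q r, M.IsPath q us r → (∃ e ∈ ts, e.2.2 = r) → ∃ e ∈ ts, e.2.2 = q := by
    intro us
    induction us with
    | nil => rintro q r rfl hr; exact hr
    | cons u us ih =>
      rintro q r ⟨hu, rfl, hus⟩ hr
      obtain ⟨e, he, heu⟩ := ih _ _ hus hr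
      obtain rfl := huniq e (hp.mem_F he) u hu heu (hav e he)
      exact hp.exists_target_eq_source he
  obtain ⟨us, hus, -⟩ := h.exists_path_to_one hb
  obtain ⟨e, he, heb⟩ := hback us b one hus (hp.exists_target_eq_end hne)
  exact hav e he heb

/-- Each transition lies on a cycle simple in `one`. -/
theorem exists_simpleCycleIn_mem (h : M.IsSemiFlower one) {e : Q × A × Q} (he : e ∈ M.F) :
    ∃ ts, M.SimpleCycleIn one ts ∧ e ∈ ts := by
  obtain ⟨us, hus, hu⟩ := h.exists_path_from_one (M.F_src e he)
  obtain ⟨vs, hvs, hv⟩ := h.exists_path_to_one (M.F_tgt e he)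
  have hp : M.IsPath e.1 (e :: vs) one := ⟨he, rfl, hvs⟩
  refine ⟨us ++ e :: vs, ⟨by simp, isPath_append.2 ⟨_, hus, hp⟩, fun t ht => ?_⟩, by simp⟩
  rw [List.dropLast_append_of_ne_nil (by simp), List.mem_append] at ht
  rcases ht with ht | ht
  · exact hu t ht
  · obtain ⟨s, hs, hst⟩ := hp.exists_source_eq_target ht
    exact hst ▸ hv s hs

/-- A simple cycle enters a state through at most one transition. -/
theorem eq_of_mem_of_target_eq (h : M.IsSemiFlower one) {ts : List (Q × A × Q)}
    (hc : M.SimpleCycleIn one ts) {e e' : Q × A × Q} (he : e ∈ ts) (he' : e' ∈ ts)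
    (hee' : e.2.2 = e'.2.2) : e = e' := by
  obtain ⟨us, vs, rfl⟩ := List.append_of_mem he
  simp only [List.mem_append, List.mem_cons] at he'
  rcases he' with he' | rfl | he'
  · obtain ⟨xs, ys, rfl⟩ := List.append_of_mem he'
    have hc' : M.SimpleCycleIn one (xs ++ e' :: (ys ++ e :: vs)) := by simpa using hc
    exact absurd hee' (h.target_ne_of_simpleCycleIn hc' (by simp))
  · rfl
  · exact absurd hee'.symm (h.target_ne_of_simpleCycleIn hc he')

/-- A cycle simple in `one` is determined by its transition entering the unique bpi. -/
theorem simpleCycleIn_unique (h : M.IsSemiFlower one)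
    (huniq : ∀ t ∈ M.F, ∀ t' ∈ M.F, t.2.2 = t'.2.2 → t.2.2 ≠ b → t = t')
    {ts ts' : List (Q × A × Q)} (hc : M.SimpleCycleIn one ts) (hc' : M.SimpleCycleIn one ts')
    {e : Q × A × Q} (he : e ∈ ts) (he' : e ∈ ts') (heb : e.2.2 = b) : ts = ts' := by
  obtain ⟨us, vs, rfl⟩ := List.append_of_mem he
  obtain ⟨us', vs', rfl⟩ := List.append_of_mem he'
  obtain ⟨_, hus, -, rfl, hvs⟩ := isPath_append.1 hc.2.1
  obtain ⟨_, hus', -, rfl, hvs'⟩ := isPath_append.1 hc'.2.1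
  have avoid_before : ∀ t ∈ us, t.2.2 ≠ e.2.2 := by
    intro t ht
    obtain ⟨xs, ys, rfl⟩ := List.append_of_mem ht
    exact (h.target_ne_of_simpleCycleIn (us := xs) (t := t) (vs := ys ++ e :: vs)
      (by simpa using hc) (by simp)).symm
  have eq_before : ∀ {xs ys zs : List (Q × A × Q)}, M.SimpleCycleIn one (xs ++ e :: zs) →
      M.IsPath one xs e.1 → M.IsPath one ys e.1 → ys <:+ xs → ys = xs := by
    intro xs ys zs hc hxs hys hsuf
    refine (hxs.eq_or_split_of_isSuffix hys hsuf).resolve_right ?_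
    rintro ⟨as, a, rfl, ha⟩
    have := SimpleCycleIn.eq_nil_of_target (us := as) (t := a) (by simpa using hc) ha
    simp at this
  have eq_after : ∀ {xs ys zs : List (Q × A × Q)}, M.SimpleCycleIn one (zs ++ e :: xs) →
      M.IsPath e.2.2 xs one → M.IsPath e.2.2 ys one → ys <:+ xs → ys = xs := by
    intro xs ys zs hc hxs hys hsuf
    refine (hxs.eq_or_split_of_isSuffix hys hsuf).resolve_right ?_
    rintro ⟨as, a, rfl, ha⟩
    exact h.target_ne_of_simpleCycleIn hc (t' := a) (by simp) ha
  have hU : us = us' := (hus.isSuffix_or_isSuffix huniq hus' (heb ▸ avoid_before)).elim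
    (eq_before hc' hus' hus) fun hs => (eq_before hc hus hus' hs).symm
  have hV : vs = vs' :=
    (hvs.isSuffix_or_isSuffix huniq hvs'
      (heb ▸ fun t ht => h.target_ne_of_simpleCycleIn hc ht)).elim
    (eq_after hc' hvs' hvs) fun hs => (eq_after hc hvs hvs' hs).symm
  rw [hU, hV]

variable [DecidableEq Q]

/-- The rank of the language of a deterministic semi-flower automaton with a unique bpi is the
indegree of that bpi. -/
theorem rkL_lang_eq_indeg (h : M.IsSemiFlower one) (hdet : M.Deterministic)
    (hb : M.IsBpi b) (hub : ∀ q, M.IsBpi q → q = b) : rkL M.lang = M.indeg b := by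
  classical
  have huniq := eq_of_target_eq_of_unique_bpi hub
  obtain ⟨e₀, he₀⟩ := Finset.card_pos.1 (zero_lt_two.trans_le hb)
  have hbs : b ∈ M.states := by
    obtain ⟨heF, rfl⟩ := Finset.mem_filter.1 he₀
    exact M.F_tgt _ heF
  choose! c hc hmem using fun e (he : e ∈ M.F) => h.exists_simpleCycleIn_mem he
  have himage : minGen M.lang = (fun e => label (c e)) '' (M.F.filter fun t => t.2.2 = b) := by
    rw [h.minGen_lang hdet]
    ext w
    constructor
    · rintro ⟨ts, hts, rfl⟩
      obtain ⟨e, he, heb⟩ := h.exists_mem_target_eq huniq hbs hts.1 hts.2.1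
      have heF := hts.2.1.mem_F he
      refine ⟨e, by simp [heF, heb], ?_⟩
      exact congrArg label (h.simpleCycleIn_unique huniq (hc e heF) hts (hmem e heF) he heb)
    · rintro ⟨e, he, rfl⟩
      exact ⟨c e, hc e (Finset.mem_filter.1 (Finset.mem_coe.1 he)).1, rfl⟩
  rw [rkL, himage, Set.InjOn.ncard_image, Set.ncard_coe_finset, indeg]
  intro e he e' he' hee'
  obtain ⟨he, heb⟩ := Finset.mem_filter.1 (Finset.mem_coe.1 he)
  obtain ⟨he', heb'⟩ := Finset.mem_filter.1 (Finset.mem_coe.1 he')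
  have hcc := (hc e he).2.1.eq_of_label_eq hdet.2 (hc e' he').2.1 hee'
  exact h.eq_of_mem_of_target_eq (hc e he) (hmem e he) (hcc ▸ hmem e' he') (heb.trans heb'.symm)

theorem sum_outdeg_sub_one (h : M.IsSemiFlower one)
    (hb : M.IsBpi b) (hub : ∀ q, M.IsBpi q → q = b) :
    ∑ q ∈ M.states, (M.outdeg q - 1) = M.indeg b - 1 := by
  obtain ⟨e₀, he₀⟩ := Finset.card_pos.1 (zero_lt_two.trans_le hb)
  obtain ⟨heF, rfl⟩ := Finset.mem_filter.1 he₀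
  have hin : ∑ q ∈ M.states, M.indeg q = M.F.card :=
    (Finset.card_eq_sum_card_fiberwise fun t ht => M.F_tgt t ht).symm
  have hout : ∑ q ∈ M.states, M.outdeg q = M.F.card :=
    (Finset.card_eq_sum_card_fiberwise fun t ht => M.F_src t ht).symm
  have hsingle : ∑ q ∈ M.states, (M.indeg q - 1) = M.indeg e₀.2.2 - 1 := by
    refine Finset.sum_eq_single_of_mem _ (M.F_tgt _ heF) fun q _ hq => ?_
    have := mt (hub q) hq
    unfold IsBpi at this
    omega
  rw [← hsingle, Finset.sum_tsub_distrib, Finset.sum_tsub_distrib, hin, hout]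
  · intro q hq
    obtain ⟨t, ht, htq⟩ := h.exists_target ⟨_, heF⟩ hq
    exact Finset.card_pos.2 ⟨t, Finset.mem_filter.2 ⟨ht, htq⟩⟩
  · intro q hq
    obtain ⟨t, ht, htq⟩ := h.exists_source ⟨_, heF⟩ hq
    exact Finset.card_pos.2 ⟨t, Finset.mem_filter.2 ⟨ht, htq⟩⟩

theorem rrk_lang_eq_sum (h : M.IsSemiFlower one) (hdet : M.Deterministic)
    (hb : ∃! b, M.IsBpi b) : rrk M.lang = ∑ q ∈ M.states, (M.outdeg q - 1) := by
  obtain ⟨b, hb, hub⟩ := hb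
  rw [rrk, h.rkL_lang_eq_indeg hdet hb hub, h.sum_outdeg_sub_one hb hub]

end Bpi

end IsSemiFlower

end FA

theorem Nat.sub_one_le_mul_sub_one {k m n : ℕ} (hm : k ≤ m) (hn : k ≤ n) :
    k - 1 ≤ (m - 1) * (n - 1) := by
  rcases Nat.lt_or_ge k 2 with hk | hk
  · omega
  · exact (Nat.sub_le_sub_right hm 1).trans (Nat.le_mul_of_pos_right _ (by omega))

/-- Giambruno–Restivo, HNP: if `H` and `K` are accepted by deterministic
semi-flower automata, each with a unique bpi, and the trim part of the product automaton is a
semi-flower automaton with a unique bpi, then `r̃k(H ∩ K) ≤ r̃k(H) ⬝ r̃k(K)`. -/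
theorem hanna_neumann_unique_bpi
    {Q Q' A : Type*} [DecidableEq Q] [DecidableEq Q'] [DecidableEq A] [Fintype A]
    (MH : FA Q A) (MK : FA Q' A) (oneH : Q) (oneK : Q')
    (hdetH : MH.Deterministic) (hdetK : MK.Deterministic)
    (hsfH : MH.IsSemiFlower oneH) (hsfK : MK.IsSemiFlower oneK)
    (hbH : ∃! b, MH.IsBpi b) (hbK : ∃! b, MK.IsBpi b)
    (H K : Submonoid (FreeMonoid A))
    (hHl : (H : Set (FreeMonoid A)) = MH.lang) (hKl : (K : Set (FreeMonoid A)) = MK.lang)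
    (hsfP : ((MH.prod MK).trimPart).IsSemiFlower (oneH, oneK))
    (hbP : ∃! b, ((MH.prod MK).trimPart).IsBpi b) :
    rrk ((H : Set (FreeMonoid A)) ∩ (K : Set (FreeMonoid A))) ≤
      rrk (H : Set (FreeMonoid A)) * rrk (K : Set (FreeMonoid A)) := by
  classical
  have hdetP : ((MH.prod MK).trimPart).Deterministic := by
    refine ⟨by simp [hsfP.init], fun p a q q' h h' => ?_⟩
    exact (FA.prod_deterministic hdetH hdetK).2 p a q q'
      (FA.trimPart_F_subset _ h) (FA.trimPart_F_subset _ h')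
  rw [hHl, hKl, ← FA.lang_prod, ← FA.lang_trimPart, hsfP.rrk_lang_eq_sum hdetP hbP,
    hsfH.rrk_lang_eq_sum hdetH hbH, hsfK.rrk_lang_eq_sum hdetK hbK, Finset.sum_mul_sum,
    ← Finset.sum_product']
  calc ∑ q ∈ (MH.prod MK).trimPart.states, ((MH.prod MK).trimPart.outdeg q - 1)
      ≤ ∑ q ∈ (MH.prod MK).trimPart.states, (MH.outdeg q.1 - 1) * (MK.outdeg q.2 - 1) := by
        refine Finset.sum_le_sum fun q _ => ?_
        have hq := FA.outdeg_mono (FA.trimPart_F_subset (MH.prod MK)) q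
        exact Nat.sub_one_le_mul_sub_one (hq.trans (FA.outdeg_prod_le_left hdetK q))
          (hq.trans (FA.outdeg_prod_le_right hdetH q))
    _ ≤ ∑ q ∈ MH.states ×ˢ MK.states, (MH.outdeg q.1 - 1) * (MK.outdeg q.2 - 1) :=
        Finset.sum_le_sum_of_subset (Finset.filter_subset _ _)
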